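/- arXiv:1711.06716 — 2 statements merged into one kernel-verified Lean document; each statement's English description precedes it below -/
import Mathlib

section
/- Let C be a category and A an object of C. Suppose there exists a natural number k such that there is a chain of length k for A but no chain of length k+1 for A (i.e., D(A) = k < ∞). Then there is an s-chain of length k for A; consequently the depth and the strong depth of A coincide. -/
open CategoryTheory

universe v u

/-- `X` is dominated by `Y` (`X ≤ᵈ Y`): `X` is a retract of `Y`. -/
def Dominated {C : Type u} [Category.{v} C] (X Y : C) : Prop :=
  ∃ (f : X ⟶ Y) (g : Y ⟶ X), f ≫ g = 𝟙 X

/-- `X` is strongly dominated by `Y` (`X <ˢ Y`). -/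
def StronglyDominated {C : Type u} [Category.{v} C] (X Y : C) : Prop :=
  Dominated X Y ∧ ¬ Dominated Y X

/-- `X` is properly dominated by `Y` (`X <ᵖ Y`). -/
def ProperlyDominated {C : Type u} [Category.{v} C] (X Y : C) : Prop :=
  Dominated X Y ∧ ¬ Nonempty (X ≅ Y)

/-- `A` has the d-equality property. -/
def DEquality {C : Type u} [Category.{v} C] (A : C) : Prop :=
  ∀ X : C, Dominated X A → Dominated A X → Nonempty (X ≅ A)

theorem Dominated.trans {C : Type u} [Category.{v} C] {X Y Z : C}
    (h₁ : Dominated X Y) (h₂ : Dominated Y Z) : Dominated X Z := by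
  obtain ⟨f, g, h⟩ := h₁
  obtain ⟨f', g', h'⟩ := h₂
  exact ⟨f ≫ f', g' ≫ g, by rw [Category.assoc, reassoc_of% h', h]⟩

/-- Two non-isomorphic objects dominating each other give an infinite proper chain, by
alternating between them. -/
theorem exists_infinite_chain_of_mutually_dominated {C : Type u} [Category.{v} C] {A X Y : C}
    (hXA : Dominated X A) (hYX : ProperlyDominated Y X) (hXY : Dominated X Y) :
    ∃ Z : ℕ → C, Dominated (Z 1) A ∧ ∀ i, ProperlyDominated (Z (i + 1)) (Z i) := by
  classical
  refine ⟨fun n => if Even n then Y else X, by simpa using hXA, fun i => ?_⟩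
  have hXY' : ProperlyDominated X Y := ⟨hXY, fun ⟨e⟩ => hYX.2 ⟨e.symm⟩⟩
  by_cases hi : Even i
  · simpa [Nat.even_add_one, hi] using hXY'
  · simpa [Nat.even_add_one, hi] using hYX

/-- If `D(A) = k < ∞` (there is a chain of length `k` for `A` but no chain of length
`k + 1`), then there is an s-chain of length `k` for `A`; hence depth and strong depth
of `A` coincide. -/
theorem sChain_of_depth_eq
    {C : Type u} [Category.{v} C] (A : C) (k : ℕ)
    (hex : ∃ X : ℕ → C, Dominated (X 1) A ∧
        ∀ i, 1 ≤ i → i + 1 ≤ k → ProperlyDominated (X (i + 1)) (X i))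
    (hno : ¬ ∃ X : ℕ → C, Dominated (X 1) A ∧
        ∀ i, 1 ≤ i → i ≤ k → ProperlyDominated (X (i + 1)) (X i)) :
    ∃ X : ℕ → C, Dominated (X 1) A ∧
      ∀ i, 1 ≤ i → i + 1 ≤ k → StronglyDominated (X (i + 1)) (X i) := by
  obtain ⟨X, hXA, hX⟩ := hex
  have hdom : ∀ i, 1 ≤ i → i ≤ k → Dominated (X i) A := by
    intro i hi
    induction i, hi using Nat.le_induction with
    | base => exact fun _ => hXA
    | succ i hi ih => exact fun hik => (hX i hi hik).1.trans (ih (by lia))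
  refine ⟨X, hXA, fun i hi hik => ⟨(hX i hi hik).1, fun hback => hno ?_⟩⟩
  obtain ⟨Z, hZA, hZ⟩ :=
    exists_infinite_chain_of_mutually_dominated (hdom i hi (by lia)) (hX i hi hik) hback
  exact ⟨Z, hZA, fun j _ _ => hZ j⟩
end

section
/- Let F be a free group of finite rank k (F = FreeGroup (Fin k)). Then the depth and the strong depth of F are equal to k+1: there exist groups F = F_0, F_1, …, F_{k+1} with F_1 ≤^d F_0 and F_{i+1} <^s F_i for 1 ≤ i ≤ k (an s-chain of length k+1, namely the free groups of ranks k, k−1, …, 1, 0), and there is no chain of length k+2 for F (no groups H_1, …, H_{k+2} with H_{k+2} <^p ⋯ <^p H_1 ≤^d F). -/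
universe u v

/-- `H ≤ᵈ G` in the category of groups, with explicitly given group structures. -/
def GrpDominatedI (H : Type u) (G : Type v) (iH : Group H) (iG : Group G) : Prop :=
  letI := iH; letI := iG
  ∃ (g : G →* H) (f : H →* G), ∀ h, g (f h) = h

/-- `H` and `G` are isomorphic groups, with explicitly given group structures. -/
def GrpIsoI (H : Type u) (G : Type v) (iH : Group H) (iG : Group G) : Prop :=
  letI := iH; letI := iG
  Nonempty (H ≃* G)

/-- `H <ˢ G`: strong domination. -/
def GrpSDomI (H : Type u) (G : Type v) (iH : Group H) (iG : Group G) : Prop :=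
  GrpDominatedI H G iH iG ∧ ¬ GrpDominatedI G H iG iH

/-- `H <ᵖ G`: proper domination. -/
def GrpPDomI (H : Type u) (G : Type v) (iH : Group H) (iG : Group G) : Prop :=
  GrpDominatedI H G iH iG ∧ ¬ GrpIsoI H G iH iG

theorem FreeGroup.finite_and_card_le_of_surjective {α : Type u} {β : Type v} [Finite α]
    (f : FreeGroup α →* FreeGroup β) (hf : Function.Surjective f) :
    Finite β ∧ Nat.card β ≤ Nat.card α := by
  let Z := Multiplicative (ZMod 2)
  have : Finite Z := inferInstanceAs (Finite (ZMod 2))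
  have hZ : Nat.card Z = 2 := Nat.card_zmod 2
  let φ : (β → Z) → (α → Z) := fun x => FreeGroup.lift.symm ((FreeGroup.lift x).comp f)
  have hφ : Function.Injective φ := fun x y hxy => by
    have h := FreeGroup.lift.symm.injective hxy
    exact FreeGroup.lift.injective ((MonoidHom.cancel_right hf).1 h)
  have hfin : Finite (β → Z) := Finite.of_injective φ hφ
  have hβ : Finite β := by
    classical
    refine Finite.of_injective
      (fun b : β => (Pi.mulSingle b (Multiplicative.ofAdd (1 : ZMod 2)) : β → Z)) ?_
    intro b c hbc
    by_contra hne
    have h := congrFun hbc b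
    simp only [Pi.mulSingle_eq_same, Pi.mulSingle_eq_of_ne hne] at h
    exact one_ne_zero (α := ZMod 2) (Multiplicative.ofAdd.injective h)
  refine ⟨hβ, ?_⟩
  have h := Nat.card_le_card_of_injective φ hφ
  rw [Nat.card_fun, Nat.card_fun, hZ] at h
  exact (Nat.pow_le_pow_iff_right one_lt_two).1 h

theorem FreeGroup.sDom_of_lt {m n : ℕ} (h : m < n) :
    GrpSDomI (FreeGroup (Fin m)) (FreeGroup (Fin n)) inferInstance inferInstance := by
  refine ⟨⟨FreeGroup.lift fun i => if hi : i.1 < m then FreeGroup.of ⟨i.1, hi⟩ else 1,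
    FreeGroup.map (Fin.castLE h.le), fun x => ?_⟩, ?_⟩
  · rw [← MonoidHom.comp_apply]
    refine DFunLike.congr_fun (?_ : _ = MonoidHom.id _) x
    ext i
    simp
  · rintro ⟨g, f, hgf⟩
    have := (FreeGroup.finite_and_card_le_of_surjective g fun x => ⟨f x, hgf x⟩).2
    simp only [Nat.card_fin] at this
    omega

/-- A retract of a free group of rank `n` is free of rank at most `n`. -/
theorem FreeGroup.exists_mulEquiv_of_retract {n : ℕ} {H : Type u} [Group H]
    (g : FreeGroup (Fin n) →* H) (f : H →* FreeGroup (Fin n)) (hgf : ∀ h, g (f h) = h) :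
    ∃ r ≤ n, Nonempty (H ≃* FreeGroup (Fin r)) := by
  have hf : Function.Injective f := Function.LeftInverse.injective hgf
  let e := (MonoidHom.ofInjective hf).trans (IsFreeGroup.toFreeGroup f.range)
  obtain ⟨hfin, hcard⟩ := FreeGroup.finite_and_card_le_of_surjective
    (e.toMonoidHom.comp g) (e.surjective.comp fun x => ⟨f x, hgf x⟩)
  rw [Nat.card_fin] at hcard
  exact ⟨_, hcard, ⟨e.trans (FreeGroup.freeGroupCongr (Finite.equivFin _))⟩⟩

/-- A proper retract of a free group of rank `n` is free of rank less than `n`. -/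
theorem GrpPDomI.exists_mulEquiv_freeGroup {n : ℕ} {H : Type u} {G : Type v}
    [iH : Group H] [iG : Group G] (h : GrpPDomI H G iH iG) (e : G ≃* FreeGroup (Fin n)) :
    ∃ r < n, Nonempty (H ≃* FreeGroup (Fin r)) := by
  obtain ⟨⟨g, f, hgf⟩, hiso⟩ := h
  obtain ⟨r, hr, ⟨e'⟩⟩ := FreeGroup.exists_mulEquiv_of_retract
    (g.comp e.symm.toMonoidHom) (e.toMonoidHom.comp f) (fun x => by simp [hgf])
  refine ⟨r, lt_of_le_of_ne hr ?_, ⟨e'⟩⟩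
  rintro rfl
  exact hiso ⟨e'.trans e.symm⟩

/-- The depth and the strong depth of the free group of rank `k` equal `k + 1`:
there is an s-chain of length `k + 1` for `FreeGroup (Fin k)`, and there is no chain of
length `k + 2` for it. -/
theorem depth_of_freeGroup (k : ℕ) :
    (∃ (F : ℕ → Type) (inst : ∀ n, Group (F n)),
      GrpDominatedI (F 1) (FreeGroup (Fin k)) (inst 1) inferInstance ∧
      ∀ i, 1 ≤ i → i ≤ k → GrpSDomI (F (i + 1)) (F i) (inst (i + 1)) (inst i)) ∧
    (∀ (H : ℕ → Type u) (inst : ∀ n, Group (H n)),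
      ¬ (GrpDominatedI (H 1) (FreeGroup (Fin k)) (inst 1) inferInstance ∧
        ∀ i, 1 ≤ i → i ≤ k + 1 → GrpPDomI (H (i + 1)) (H i) (inst (i + 1)) (inst i))) := by
  refine ⟨⟨fun n => FreeGroup (Fin (k + 1 - n)), fun n => inferInstance,
    ⟨MonoidHom.id _, MonoidHom.id _, fun _ => rfl⟩,
    fun i _ hik => FreeGroup.sDom_of_lt (by omega)⟩, ?_⟩
  rintro H inst ⟨⟨g, f, hgf⟩, hchain⟩
  have key : ∀ i ≤ k + 1, ∃ r, r + i ≤ k ∧ Nonempty (H (i + 1) ≃* FreeGroup (Fin r)) := by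
    intro i
    induction i with
    | zero => exact fun _ => FreeGroup.exists_mulEquiv_of_retract g f hgf
    | succ i ih =>
      intro hi
      obtain ⟨r, hr, ⟨e⟩⟩ := ih (by omega)
      obtain ⟨s, hs, he⟩ := (hchain (i + 1) (by omega) hi).exists_mulEquiv_freeGroup e
      exact ⟨s, by omega, he⟩
  obtain ⟨r, hr, -⟩ := key (k + 1) le_rfl
  omega
end
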